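/- For all real ν > -1/2 and all x > 0, x^{ν-1} I_{ν+1}(x)/(√π 2^{ν-1} Γ(ν+1/2)) < I_ν(x) L_{ν-1}(x) − I_{ν-1}(x) L_ν(x) < (ν+1) x^{ν-1} I_{ν+1}(x)/(√π 2^{ν-1} Γ(ν+3/2)). -/

import Mathlib

open Real MeasureTheory

/-- The modified Bessel function of the first kind
`I_ν(x) = Σ_{k=0}^∞ (1/(k! Γ(k+ν+1))) (x/2)^{2k+ν}`. -/
noncomputable def besselI (ν x : ℝ) : ℝ :=
  ∑' k : ℕ, (1 / ((k.factorial : ℝ) * Real.Gamma ((k : ℝ) + ν + 1))) *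
    (x / 2) ^ (2 * (k : ℝ) + ν)

/-- The modified Struve function
`L_ν(x) = Σ_{k=0}^∞ (x/2)^{2k+ν+1}/(Γ(k+3/2) Γ(k+ν+3/2))`. -/
noncomputable def struveL (ν x : ℝ) : ℝ :=
  ∑' k : ℕ, (x / 2) ^ (2 * (k : ℝ) + ν + 1) /
    (Real.Gamma ((k : ℝ) + 3 / 2) * Real.Gamma ((k : ℝ) + ν + 3 / 2))

open Filter

/-- The coefficient `1 / (k! Γ(k+ν+1))` of the series of `besselI ν`. -/
noncomputable def besselCoeff (ν : ℝ) (k : ℕ) : ℝ :=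
  1 / ((k.factorial : ℝ) * Real.Gamma ((k : ℝ) + ν + 1))

/-- The coefficient `1 / (Γ(k+3/2) Γ(k+ν+3/2))` of the series of `struveL ν`. -/
noncomputable def struveCoeff (ν : ℝ) (k : ℕ) : ℝ :=
  1 / (Real.Gamma ((k : ℝ) + 3 / 2) * Real.Gamma ((k : ℝ) + ν + 3 / 2))

theorem one_div_Gamma_eq_self_mul (s : ℝ) :
    1 / Real.Gamma s = s * (1 / Real.Gamma (s + 1)) := by
  rcases eq_or_ne s 0 with rfl | hs
  · simp [Real.Gamma_zero]
  · rw [Real.Gamma_add_one hs, one_div, one_div, mul_inv, mul_inv_cancel_left₀ hs]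

theorem besselCoeff_sub_one (ν : ℝ) (k : ℕ) :
    besselCoeff (ν - 1) k = (k + ν) * besselCoeff ν k := by
  have h := one_div_Gamma_eq_self_mul ((k : ℝ) + ν)
  unfold besselCoeff
  rw [show (k : ℝ) + (ν - 1) + 1 = k + ν by ring, ← one_div_mul_one_div, h,
    ← one_div_mul_one_div]
  ring

theorem struveCoeff_sub_one (ν : ℝ) (k : ℕ) :
    struveCoeff (ν - 1) k = (k + ν + 1 / 2) * struveCoeff ν k := by
  have h := one_div_Gamma_eq_self_mul ((k : ℝ) + ν + 1 / 2)
  unfold struveCoeff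
  rw [show (k : ℝ) + (ν - 1) + 3 / 2 = k + ν + 1 / 2 by ring, ← one_div_mul_one_div, h,
    show (k : ℝ) + ν + 1 / 2 + 1 = k + ν + 3 / 2 by ring, ← one_div_mul_one_div]
  ring

theorem besselCoeff_succ (ν : ℝ) (k : ℕ) :
    ((k : ℝ) + 1) * (k + 1 + ν) * besselCoeff ν (k + 1) = besselCoeff ν k := by
  have h := one_div_Gamma_eq_self_mul ((k : ℝ) + ν + 1)
  have hk : (k : ℝ) + 1 ≠ 0 := by positivity
  unfold besselCoeff
  rw [← one_div_mul_one_div, ← one_div_mul_one_div, h, Nat.factorial_succ]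
  push_cast
  rw [show (k : ℝ) + 1 + ν + 1 = k + ν + 1 + 1 by ring, ← one_div_mul_one_div]
  field_simp
  ring

theorem struveCoeff_succ (ν : ℝ) (k : ℕ) :
    ((k : ℝ) + 3 / 2) * (k + ν + 3 / 2) * struveCoeff ν (k + 1) = struveCoeff ν k := by
  have h := one_div_Gamma_eq_self_mul ((k : ℝ) + ν + 3 / 2)
  have h' := one_div_Gamma_eq_self_mul ((k : ℝ) + 3 / 2)
  unfold struveCoeff
  rw [← one_div_mul_one_div, ← one_div_mul_one_div, h, h']
  push_cast
  rw [show (k : ℝ) + 1 + ν + 3 / 2 = k + ν + 3 / 2 + 1 by ring,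
    show (k : ℝ) + 1 + 3 / 2 = k + 3 / 2 + 1 by ring]
  ring

theorem struveCoeff_zero (ν : ℝ) :
    1 / 2 * (ν + 1 / 2) * struveCoeff ν 0 = 1 / (Real.sqrt π * Real.Gamma (ν + 1 / 2)) := by
  have h := one_div_Gamma_eq_self_mul (ν + 1 / 2)
  have h' := one_div_Gamma_eq_self_mul (1 / 2)
  unfold struveCoeff
  rw [← Real.Gamma_one_half_eq, ← one_div_mul_one_div, ← one_div_mul_one_div, h, h']
  norm_num
  rw [show ν + 1 / 2 + 1 = ν + 3 / 2 by ring]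
  ring

/-- A power series whose coefficients satisfy a two-term recurrence with quadratically growing
denominators converges absolutely everywhere. -/
theorem summable_norm_mul_pow_of_recurrence {c : ℕ → ℝ} {α β : ℝ}
    (hc : ∀ k : ℕ, ((k : ℝ) + α) * (k + β) * c (k + 1) = c k) (s : ℝ) :
    Summable fun k => ‖c k * s ^ k‖ := by
  have hα : Tendsto (fun k : ℕ => (k : ℝ) + α) atTop atTop :=
    tendsto_atTop_add_const_right _ _ tendsto_natCast_atTop_atTop
  have hβ : Tendsto (fun k : ℕ => (k : ℝ) + β) atTop atTop :=
    tendsto_atTop_add_const_right _ _ tendsto_natCast_atTop_atTop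
  refine summable_of_ratio_norm_eventually_le (r := 1 / 2) (by norm_num) ?_
  filter_upwards [(hα.atTop_mul_atTop₀ hβ).eventually_ge_atTop (2 * |s|)] with k hk
  simp only [norm_mul, Real.norm_eq_abs, abs_abs, pow_succ]
  have hp : |c k| = (k + α) * (k + β) * |c (k + 1)| := by
    rw [← hc k, abs_mul, abs_of_nonneg (le_trans (by positivity) hk)]
  rw [hp]
  have h := mul_le_mul_of_nonneg_right hk
    (mul_nonneg (abs_nonneg (c (k + 1))) (abs_nonneg (s ^ k)))
  linarith

theorem summable_norm_besselCoeff_mul_pow (ν s : ℝ) :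
    Summable fun k => ‖besselCoeff ν k * s ^ k‖ :=
  summable_norm_mul_pow_of_recurrence (α := 1) (β := 1 + ν)
    (fun k => by rw [← besselCoeff_succ ν k]; ring) s

theorem summable_norm_struveCoeff_mul_pow (ν s : ℝ) :
    Summable fun k => ‖struveCoeff ν k * s ^ k‖ :=
  summable_norm_mul_pow_of_recurrence (α := 3 / 2) (β := ν + 3 / 2)
    (fun k => by rw [← struveCoeff_succ ν k]; ring) s

theorem besselI_eq (ν : ℝ) {x : ℝ} (hx : 0 < x) :
    besselI ν x = (x / 2) ^ ν * ∑' k, besselCoeff ν k * ((x / 2) ^ 2) ^ k := by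
  unfold besselI
  rw [← tsum_mul_left]
  refine tsum_congr fun k => ?_
  rw [Real.rpow_add (by positivity), ← pow_mul, ← Real.rpow_natCast]
  push_cast [besselCoeff]
  ring

theorem struveL_eq (ν : ℝ) {x : ℝ} (hx : 0 < x) :
    struveL ν x = (x / 2) ^ (ν + 1) * ∑' k, struveCoeff ν k * ((x / 2) ^ 2) ^ k := by
  unfold struveL
  rw [← tsum_mul_left]
  refine tsum_congr fun k => ?_
  rw [add_assoc, Real.rpow_add (by positivity), ← pow_mul, ← Real.rpow_natCast]
  push_cast [struveCoeff]
  ring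

theorem sum_antidiagonal_besselCoeff_mul_struveCoeff (ν : ℝ) (n : ℕ) :
    ((n : ℝ) + ν + 1 / 2) * ∑ p ∈ Finset.HasAntidiagonal.antidiagonal n,
        (besselCoeff ν p.1 * struveCoeff (ν - 1) p.2 -
          besselCoeff (ν - 1) p.1 * struveCoeff ν p.2) =
      besselCoeff ν n / (Real.sqrt π * Real.Gamma (ν + 1 / 2)) := by
  have hsplit : ((n : ℝ) + ν + 1 / 2) * ∑ p ∈ Finset.HasAntidiagonal.antidiagonal n,
        (besselCoeff ν p.1 * struveCoeff (ν - 1) p.2 -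
          besselCoeff (ν - 1) p.1 * struveCoeff ν p.2) =
      (∑ p ∈ Finset.HasAntidiagonal.antidiagonal n,
        besselCoeff ν p.1 * (((p.2 : ℝ) + 1 / 2) * (p.2 + ν + 1 / 2) * struveCoeff ν p.2)) -
      ∑ p ∈ Finset.HasAntidiagonal.antidiagonal n,
        ((p.1 : ℝ) * (p.1 + ν) * besselCoeff ν p.1) * struveCoeff ν p.2 := by
    rw [← Finset.sum_sub_distrib, Finset.mul_sum]
    refine Finset.sum_congr rfl fun p hp => ?_
    rw [← Finset.HasAntidiagonal.mem_antidiagonal.mp hp, besselCoeff_sub_one, struveCoeff_sub_one]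
    push_cast
    ring
  have hzero := struveCoeff_zero ν
  rw [hsplit]
  cases n with
  | zero =>
    simp only [Finset.Nat.antidiagonal_zero, Finset.sum_singleton, Nat.cast_zero, zero_add,
      zero_mul, sub_zero]
    rw [hzero]
    ring
  | succ n =>
    rw [Finset.Nat.sum_antidiagonal_succ', Finset.Nat.sum_antidiagonal_succ]
    simp only [Nat.cast_zero, zero_add, zero_mul]
    have hshift : ∀ p : ℕ × ℕ,
        besselCoeff ν p.1 * ((((p.2 + 1 : ℕ) : ℝ) + 1 / 2) * ((p.2 + 1 : ℕ) + ν + 1 / 2) *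
          struveCoeff ν (p.2 + 1)) =
        ((p.1 + 1 : ℕ) : ℝ) * ((p.1 + 1 : ℕ) + ν) * besselCoeff ν (p.1 + 1) *
          struveCoeff ν p.2 := fun p => by
      have h := besselCoeff_succ ν p.1
      have h' := struveCoeff_succ ν p.2
      push_cast
      rw [h, ← h']
      ring
    rw [hzero, Finset.sum_congr rfl fun p _ => hshift p]
    ring

/-- The Wronskian-type combination of `besselI` and `struveL` as an explicit power series. -/
theorem besselI_mul_struveL_sub (ν : ℝ) (hν : -(1 / 2) < ν) {x : ℝ} (hx : 0 < x) :
    (Summable fun n : ℕ => besselCoeff ν n / (n + ν + 1 / 2) * ((x / 2) ^ 2) ^ n) ∧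
    besselI ν x * struveL (ν - 1) x - besselI (ν - 1) x * struveL ν x =
      (x / 2) ^ (2 * ν) / (Real.sqrt π * Real.Gamma (ν + 1 / 2)) *
        ∑' n : ℕ, besselCoeff ν n / (n + ν + 1 / 2) * ((x / 2) ^ 2) ^ n := by
  set s := (x / 2) ^ 2
  have hG : 0 < Real.sqrt π * Real.Gamma (ν + 1 / 2) :=
    mul_pos (Real.sqrt_pos.mpr Real.pi_pos) (Real.Gamma_pos_of_pos (by linarith))
  have hterm : ∀ n : ℕ,
      (∑ p ∈ Finset.HasAntidiagonal.antidiagonal n,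
        (besselCoeff ν p.1 * s ^ p.1) * (struveCoeff (ν - 1) p.2 * s ^ p.2)) -
      (∑ p ∈ Finset.HasAntidiagonal.antidiagonal n,
        (besselCoeff (ν - 1) p.1 * s ^ p.1) * (struveCoeff ν p.2 * s ^ p.2)) =
      1 / (Real.sqrt π * Real.Gamma (ν + 1 / 2)) *
        (besselCoeff ν n / (n + ν + 1 / 2) * s ^ n) := by
    intro n
    have hn : (n : ℝ) + ν + 1 / 2 ≠ 0 := by
      have : (0 : ℝ) ≤ n := n.cast_nonneg
      linarith
    have h := sum_antidiagonal_besselCoeff_mul_struveCoeff ν n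
    rw [mul_comm, ← eq_div_iff hn] at h
    calc _ = (∑ p ∈ Finset.HasAntidiagonal.antidiagonal n,
        (besselCoeff ν p.1 * struveCoeff (ν - 1) p.2 -
          besselCoeff (ν - 1) p.1 * struveCoeff ν p.2)) * s ^ n := by
          rw [← Finset.sum_sub_distrib, Finset.sum_mul]
          refine Finset.sum_congr rfl fun p hp => ?_
          rw [← Finset.HasAntidiagonal.mem_antidiagonal.mp hp, pow_add]
          ring
      _ = _ := by rw [h]; ring
  have hA := summable_norm_besselCoeff_mul_pow ν s
  have hA' := summable_norm_besselCoeff_mul_pow (ν - 1) s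
  have hB := summable_norm_struveCoeff_mul_pow ν s
  have hB' := summable_norm_struveCoeff_mul_pow (ν - 1) s
  have h1 := (summable_norm_sum_mul_antidiagonal_of_summable_norm hA hB').of_norm
  have h2 := (summable_norm_sum_mul_antidiagonal_of_summable_norm hA' hB).of_norm
  have h12 := h1.sub h2
  have heq := h1.tsum_sub h2
  simp only [hterm] at h12 heq
  refine ⟨(summable_mul_left_iff (one_div_pos.mpr hG).ne').mp h12, ?_⟩
  rw [tsum_mul_left, ← tsum_mul_tsum_eq_tsum_sum_antidiagonal_of_summable_norm hA hB',
    ← tsum_mul_tsum_eq_tsum_sum_antidiagonal_of_summable_norm hA' hB] at heq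
  rw [div_eq_mul_one_div, mul_assoc, heq, besselI_eq ν hx, besselI_eq (ν - 1) hx,
    struveL_eq ν hx, struveL_eq (ν - 1) hx]
  have e1 : (x / 2) ^ (2 * ν) = (x / 2) ^ ν * (x / 2) ^ (ν - 1 + 1) := by
    rw [← Real.rpow_add (by positivity)]; ring_nf
  have e2 : (x / 2) ^ (2 * ν) = (x / 2) ^ (ν - 1) * (x / 2) ^ (ν + 1) := by
    rw [← Real.rpow_add (by positivity)]; ring_nf
  rw [mul_sub]
  nth_rewrite 1 [e1]
  rw [e2]
  ring

theorem besselCoeff_pos {ν : ℝ} (hν : -1 < ν) (k : ℕ) : 0 < besselCoeff ν k := by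
  have hk : (0 : ℝ) ≤ k := k.cast_nonneg
  have := Real.Gamma_pos_of_pos (show 0 < (k : ℝ) + ν + 1 by linarith)
  unfold besselCoeff
  positivity

theorem rpow_mul_besselI_add_one (ν : ℝ) {x : ℝ} (hx : 0 < x) :
    x ^ (ν - 1) * besselI (ν + 1) x =
      2 ^ (ν - 1) * (x / 2) ^ (2 * ν) *
        ∑' k, besselCoeff (ν + 1) k * ((x / 2) ^ 2) ^ k := by
  have e : (x / 2) ^ (2 * ν) = (x / 2) ^ (ν - 1) * (x / 2) ^ (ν + 1) := by
    rw [← Real.rpow_add (by positivity)]; ring_nf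
  have e' : x ^ (ν - 1) = 2 ^ (ν - 1) * (x / 2) ^ (ν - 1) := by
    rw [← Real.mul_rpow (by norm_num) (by positivity)]; ring_nf
  rw [besselI_eq (ν + 1) hx, e, e']
  ring

theorem besselI_struveL_bounds (ν : ℝ) (hν : -(1 / 2) < ν) (x : ℝ) (hx : 0 < x) :
    x ^ (ν - 1) * besselI (ν + 1) x / (Real.sqrt π * 2 ^ (ν - 1) * Real.Gamma (ν + 1 / 2)) <
        besselI ν x * struveL (ν - 1) x - besselI (ν - 1) x * struveL ν x ∧
      besselI ν x * struveL (ν - 1) x - besselI (ν - 1) x * struveL ν x <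
        (ν + 1) * x ^ (ν - 1) * besselI (ν + 1) x /
          (Real.sqrt π * 2 ^ (ν - 1) * Real.Gamma (ν + 3 / 2)) := by
  obtain ⟨hsum, hW⟩ := besselI_mul_struveL_sub ν hν hx
  have hR := rpow_mul_besselI_add_one ν hx
  have hsumR := (summable_norm_besselCoeff_mul_pow (ν + 1) ((x / 2) ^ 2)).of_norm
  have hs : 0 < (x / 2) ^ 2 := by positivity
  have hG : 0 < Real.Gamma (ν + 1 / 2) := Real.Gamma_pos_of_pos (by linarith)
  have hν' : 0 < ν + 1 / 2 := by linarith
  have hG' : Real.Gamma (ν + 3 / 2) = (ν + 1 / 2) * Real.Gamma (ν + 1 / 2) := by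
    rw [← Real.Gamma_add_one hν'.ne']; ring_nf
  have hpi : 0 < Real.sqrt π := Real.sqrt_pos.mpr Real.pi_pos
  have h2 : (0 : ℝ) < 2 ^ (ν - 1) := by positivity
  have hC : 0 < (x / 2) ^ (2 * ν) / (Real.sqrt π * Real.Gamma (ν + 1 / 2)) := by positivity
  have hcoeff : ∀ n : ℕ, besselCoeff ν n = (n + ν + 1) * besselCoeff (ν + 1) n := fun n => by
    have h := besselCoeff_sub_one (ν + 1) n
    rw [add_sub_cancel_right] at h
    rw [h]
    ring
  have hpos : ∀ n : ℕ, 0 < besselCoeff (ν + 1) n := besselCoeff_pos (by linarith)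
  have hden : ∀ n : ℕ, 0 < (n : ℝ) + ν + 1 / 2 := fun n => by
    have : (0 : ℝ) ≤ n := n.cast_nonneg
    linarith
  rw [mul_assoc (ν + 1), hR, hW]
  constructor
  · have hlt : ∀ n : ℕ, besselCoeff (ν + 1) n * ((x / 2) ^ 2) ^ n <
        besselCoeff ν n / (n + ν + 1 / 2) * ((x / 2) ^ 2) ^ n := fun n => by
      refine mul_lt_mul_of_pos_right ?_ (pow_pos hs n)
      rw [lt_div_iff₀ (hden n), hcoeff n]
      nlinarith [hpos n]
    have h := mul_lt_mul_of_pos_left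
      (Summable.tsum_lt_tsum (i := 0) (fun n => (hlt n).le) (hlt 0) hsumR hsum) hC
    refine lt_of_eq_of_lt ?_ h
    field_simp
  · have hdiff : ∀ n : ℕ, (ν + 1) / (ν + 1 / 2) * besselCoeff (ν + 1) n -
        besselCoeff ν n / (n + ν + 1 / 2) =
        n * besselCoeff (ν + 1) n / (2 * (ν + 1 / 2) * (n + ν + 1 / 2)) := fun n => by
      have := hden n
      rw [hcoeff n, div_mul_eq_mul_div, div_sub_div _ _ hν'.ne' this.ne',
        div_eq_div_iff (by positivity) (by positivity)]
      ring
    have hle : ∀ n : ℕ, besselCoeff ν n / (n + ν + 1 / 2) * ((x / 2) ^ 2) ^ n ≤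
        (ν + 1) / (ν + 1 / 2) * (besselCoeff (ν + 1) n * ((x / 2) ^ 2) ^ n) := fun n => by
      rw [← mul_assoc]
      refine mul_le_mul_of_nonneg_right ?_ (pow_pos hs n).le
      rw [← sub_nonneg, hdiff n]
      have := hden n
      have := hpos n
      positivity
    have hlt : besselCoeff ν 1 / ((1 : ℕ) + ν + 1 / 2) * ((x / 2) ^ 2) ^ 1 <
        (ν + 1) / (ν + 1 / 2) * (besselCoeff (ν + 1) 1 * ((x / 2) ^ 2) ^ 1) := by
      rw [← mul_assoc]
      refine mul_lt_mul_of_pos_right ?_ (pow_pos hs 1)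
      rw [← sub_pos, hdiff 1]
      have := hden 1
      have := hpos 1
      positivity
    have h := mul_lt_mul_of_pos_left
      (Summable.tsum_lt_tsum (i := 1) hle hlt hsum (hsumR.mul_left _)) hC
    rw [tsum_mul_left] at h
    refine lt_of_lt_of_eq h ?_
    rw [hG']
    field_simp
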